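/- arXiv:2207.08791 — 2 statements merged into one kernel-verified Lean document; each statement's English description precedes it below -/
import Mathlib

section
/- Let E : ℕ → ℝ be a nondecreasing sequence with E 0 = 0 and E i ≥ 0 satisfying the Gibbs condition, and let F_E be the associated maximal-entropy function. Let n ≥ 1, let P₀ be a convex set of probability distributions on ℕⁿ with the Δ-property, and let f : P₀ → ℝ be a nonnegative function belonging to the class T_n^1(C,D) on P₀. Let p ∈ P₀ satisfy ∑_i (E i)·(p₁ i) ≤ t for some t > 0. Then for every q ∈ P₀ and every ε ∈ (0,1] with TV(p,q) ≤ ε one has f(p) − f(q) ≤ C·ε·F_E((t − t_ε(p))/ε) + D·g(ε) ≤ C·ε·F_E(t/ε) + D·g(ε), where t_ε(p) = ∑_{x ∈ ℕⁿ} E(x 1)·max(p x − ε, 0) (x 1 denoting the first coordinate of x). -/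
open scoped ENNReal
/-- `p` is a probability distribution on `α`: nonnegative entries summing to `1`. -/
def IsProbDist {α : Type*} (p : α → ℝ) : Prop := (∀ x, 0 ≤ p x) ∧ HasSum p 1

/-- Extended-real-valued Shannon entropy `H(r) = ∑ η(r i) ∈ [0,+∞]`,
where `η(x) = −x ln x`. -/
noncomputable def shEnt (r : ℕ → ℝ) : ℝ≥0∞ :=
  ∑' i, ENNReal.ofReal (Real.negMulLog (r i))

/-- Total variation distance `TV(p,q) = (1/2)·∑ |p x − q x|`. -/
noncomputable def TVd {α : Type*} (p q : α → ℝ) : ℝ := (1 / 2) * ∑' x, |p x - q x|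

/-- `g(x) = (x+1)·ln(x+1) − x·ln x` (with `g(0) = 0`, as `Real.log 0 = 0`). -/
noncomputable def gFun (x : ℝ) : ℝ := (x + 1) * Real.log (x + 1) - x * Real.log x

/-- Binary entropy `h₂(x) = η(x) + η(1−x)`. -/
noncomputable def h2 (x : ℝ) : ℝ := Real.negMulLog x + Real.negMulLog (1 - x)

/-- The `k`-th marginal of a distribution on `ℕⁿ`. -/
noncomputable def margN {n : ℕ} (p : (Fin n → ℕ) → ℝ) (k : Fin n) (j : ℕ) : ℝ :=
  ∑' x : Fin n → ℕ, if x k = j then p x else 0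

/-- `P₀` is convex (as a set of functions). -/
def ConvexDist {α : Type*} (P₀ : Set (α → ℝ)) : Prop :=
  ∀ p ∈ P₀, ∀ q ∈ P₀, ∀ lam : ℝ, 0 ≤ lam → lam ≤ 1 →
    (fun x => lam * p x + (1 - lam) * q x) ∈ P₀

/-- The Δ-property: for distinct `p, q ∈ P₀` the normalized positive and negative
parts of `p − q` belong to `P₀`. -/
def DeltaProp {α : Type*} (P₀ : Set (α → ℝ)) : Prop :=
  ∀ p ∈ P₀, ∀ q ∈ P₀, p ≠ q →
    (fun x => max (p x - q x) 0 / TVd p q) ∈ P₀ ∧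
    (fun x => max (q x - p x) 0 / TVd p q) ∈ P₀

/-- The sum `∑_{k=1}^m H(p_k)` of the entropies of the first `m` marginals. -/
noncomputable def margEntSum {n : ℕ} (m : ℕ) (p : (Fin n → ℕ) → ℝ) : ℝ≥0∞ :=
  ∑ k ∈ Finset.univ.filter (fun k : Fin n => (k : ℕ) < m), shEnt (margN p k)

/-- Membership in the class `T_n^m(C,D)` on `P₀`. -/
def InClassT {n : ℕ} (m : ℕ) (C D : ℝ) (P₀ : Set ((Fin n → ℕ) → ℝ))
    (f : ((Fin n → ℕ) → ℝ) → ℝ) : Prop :=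
  ∃ cm cp dm dp : ℝ, 0 ≤ cm ∧ 0 ≤ cp ∧ 0 ≤ dm ∧ 0 ≤ dp ∧
    cm + cp = C ∧ dm + dp = D ∧
    (∀ p ∈ P₀, ∀ q ∈ P₀, ∀ lam : ℝ, 0 ≤ lam → lam ≤ 1 →
      lam * f p + (1 - lam) * f q - dm * h2 lam ≤
        f (fun x => lam * p x + (1 - lam) * q x) ∧
      f (fun x => lam * p x + (1 - lam) * q x) ≤
        lam * f p + (1 - lam) * f q + dp * h2 lam) ∧
    (∀ p ∈ P₀, margEntSum m p ≠ ⊤ →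
      -(cm * (margEntSum m p).toReal) ≤ f p ∧ f p ≤ cp * (margEntSum m p).toReal)


/-- The Gibbs condition: `∑_i exp(−β·E i) < ∞` for every `β > 0`. -/
def GibbsCond (E : ℕ → ℝ) : Prop :=
  ∀ β : ℝ, 0 < β → Summable fun i => Real.exp (-β * E i)

/-- The mean energy `∑_i E i · p i ∈ [0,+∞]` (the terms being nonnegative for
probability distributions and nonnegative `E`). -/
noncomputable def meanE (E : ℕ → ℝ) (p : ℕ → ℝ) : ℝ≥0∞ :=
  ∑' i, ENNReal.ofReal (E i * p i)

/-- The maximal-entropy function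
`F_E(t) = sup{ H(p) : p prob. distribution on ℕ, ∑ E i · p i ≤ t }`. -/
noncomputable def FE (E : ℕ → ℝ) (t : ℝ) : ℝ :=
  sSup {h : ℝ | ∃ p : ℕ → ℝ, IsProbDist p ∧ meanE E p ≤ ENNReal.ofReal t ∧
    h = (shEnt p).toReal}

theorem gFun_monotoneOn : MonotoneOn gFun (Set.Ici 0) := by
  have hcont : Continuous gFun :=
    (Real.continuous_mul_log.comp (continuous_id.add continuous_const)).sub
      Real.continuous_mul_log
  have hderiv : ∀ x : ℝ, 0 < x → HasDerivAt gFun (Real.log (x + 1) - Real.log x) x := by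
    intro x hx
    have h1 : HasDerivAt (fun y : ℝ => (y + 1) * Real.log (y + 1)) (Real.log (x + 1) + 1) x :=
      (Real.hasDerivAt_mul_log (x := x + 1) (by positivity)).comp_add_const x 1
    have h := h1.sub (Real.hasDerivAt_mul_log hx.ne')
    exact h.congr_deriv (by ring)
  refine monotoneOn_of_deriv_nonneg (convex_Ici 0) hcont.continuousOn ?_ ?_
  · intro x hx
    rw [interior_Ici] at hx
    exact (hderiv x hx).differentiableAt.differentiableWithinAt
  · intro x hx
    rw [interior_Ici] at hx
    rw [(hderiv x hx).deriv, sub_nonneg]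
    exact Real.log_le_log hx (by linarith)

theorem gFun_zero : gFun 0 = 0 := by simp [gFun]

theorem gFun_nonneg {x : ℝ} (hx : 0 ≤ x) : 0 ≤ gFun x :=
  gFun_zero ▸ gFun_monotoneOn Set.self_mem_Ici hx hx

theorem one_add_mul_h2 {d : ℝ} (hd : 0 < d) : (1 + d) * h2 (1 / (1 + d)) = gFun d := by
  have h : 1 - 1 / (1 + d) = d / (1 + d) := by field_simp; ring
  rw [h2, h, Real.negMulLog, Real.negMulLog, Real.log_div one_ne_zero (by positivity),
    Real.log_div hd.ne' (by positivity), Real.log_one, gFun, add_comm d 1]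
  field_simp
  ring

theorem IsProbDist.le_one {α : Type*} {r : α → ℝ} (hr : IsProbDist r) (x : α) : r x ≤ 1 :=
  le_hasSum hr.2 x fun y _ => hr.1 y

theorem ofReal_margN {n : ℕ} {r : (Fin n → ℕ) → ℝ} (h0 : ∀ x, 0 ≤ r x) (hs : Summable r)
    (k : Fin n) (j : ℕ) :
    ENNReal.ofReal (margN r k j) = ∑' x, if x k = j then ENNReal.ofReal (r x) else 0 := by
  rw [margN, ENNReal.ofReal_tsum_of_nonneg]
  · exact tsum_congr fun x => by split_ifs <;> simp
  · intro x
    split_ifs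
    exacts [h0 x, le_rfl]
  · exact hs.of_nonneg_of_le (fun x => by split_ifs; exacts [h0 x, le_rfl])
      (fun x => by split_ifs; exacts [le_rfl, h0 x])

theorem margN_nonneg {n : ℕ} {r : (Fin n → ℕ) → ℝ} (h0 : ∀ x, 0 ≤ r x) (k : Fin n) (j : ℕ) :
    0 ≤ margN r k j :=
  tsum_nonneg fun x => by split_ifs; exacts [h0 x, le_rfl]

theorem tsum_mul_ofReal_margN {n : ℕ} {r : (Fin n → ℕ) → ℝ} (h0 : ∀ x, 0 ≤ r x)
    (hs : Summable r) (k : Fin n) (w : ℕ → ℝ≥0∞) :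
    ∑' j, w j * ENNReal.ofReal (margN r k j) = ∑' x, w (x k) * ENNReal.ofReal (r x) := by
  simp_rw [ofReal_margN h0 hs, ← ENNReal.tsum_mul_left]
  rw [ENNReal.tsum_comm]
  refine tsum_congr fun x => ?_
  rw [tsum_eq_single (x k) fun j hj => by rw [if_neg hj.symm, mul_zero], if_pos rfl]

theorem meanE_margN {n : ℕ} {E : ℕ → ℝ} (hE : ∀ i, 0 ≤ E i) {r : (Fin n → ℕ) → ℝ}
    (h0 : ∀ x, 0 ≤ r x) (hs : Summable r) (k : Fin n) :
    meanE E (margN r k) = ∑' x, ENNReal.ofReal (E (x k) * r x) := by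
  simp_rw [meanE, ENNReal.ofReal_mul (hE _)]
  exact tsum_mul_ofReal_margN h0 hs k fun j => ENNReal.ofReal (E j)

theorem hasSum_of_tsum_ofReal {α : Type*} {r : α → ℝ} (h0 : ∀ x, 0 ≤ r x) {a : ℝ} (ha : 0 ≤ a)
    (h : ∑' x, ENNReal.ofReal (r x) = ENNReal.ofReal a) : HasSum r a := by
  have hne : ∑' x, ENNReal.ofReal (r x) ≠ ⊤ := h ▸ ENNReal.ofReal_ne_top
  have hsum := ENNReal.hasSum_toReal hne
  rw [← ENNReal.tsum_toReal_eq fun _ => ENNReal.ofReal_ne_top, h, ENNReal.toReal_ofReal ha] at hsum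
  simpa only [ENNReal.toReal_ofReal (h0 _)] using hsum

theorem IsProbDist.margN {n : ℕ} {r : (Fin n → ℕ) → ℝ} (hr : IsProbDist r) (k : Fin n) :
    IsProbDist (margN r k) := by
  refine ⟨margN_nonneg hr.1 k, hasSum_of_tsum_ofReal (margN_nonneg hr.1 k) zero_le_one ?_⟩
  have h := tsum_mul_ofReal_margN hr.1 hr.2.summable k fun _ => 1
  simp only [one_mul] at h
  rw [h, ← ENNReal.ofReal_tsum_of_nonneg hr.1 hr.2.summable, hr.2.tsum_eq]

theorem margEntSum_one {n : ℕ} (hn : 1 ≤ n) (r : (Fin n → ℕ) → ℝ) :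
    margEntSum 1 r = shEnt (margN r ⟨0, hn⟩) := by
  have h : Finset.univ.filter (fun k : Fin n => (k : ℕ) < 1) = {⟨0, hn⟩} := by
    ext k
    simp [Fin.ext_iff]
  rw [margEntSum, h, Finset.sum_singleton]

theorem negMulLog_le_mul_add_exp {x : ℝ} (hx : 0 ≤ x) (e : ℝ) :
    Real.negMulLog x ≤ e * x + Real.exp (-e) := by
  rcases hx.eq_or_lt with rfl | hx
  · simp [Real.exp_nonneg]
  have h := Real.log_le_sub_one_of_pos (div_pos (Real.exp_pos (-e)) hx)
  rw [Real.log_div (Real.exp_pos _).ne' hx.ne', Real.log_exp] at h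
  have h' := mul_le_mul_of_nonneg_left h hx.le
  have hc : x * (Real.exp (-e) / x - 1) = Real.exp (-e) - x := by field_simp
  rw [hc] at h'
  rw [Real.negMulLog]
  nlinarith

theorem shEnt_le_meanE_add (E r : ℕ → ℝ) (hr : ∀ i, 0 ≤ r i) :
    shEnt r ≤ meanE E r + ∑' i, ENNReal.ofReal (Real.exp (-1 * E i)) := by
  rw [shEnt, meanE, ← ENNReal.tsum_add]
  refine ENNReal.tsum_le_tsum fun i => ?_
  rw [neg_one_mul]
  exact (ENNReal.ofReal_le_ofReal (negMulLog_le_mul_add_exp (hr i) (E i))).trans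
    ENNReal.ofReal_add_le

theorem GibbsCond.tsum_ne_top {E : ℕ → ℝ} (h : GibbsCond E) :
    ∑' i, ENNReal.ofReal (Real.exp (-1 * E i)) ≠ ⊤ := by
  rw [← ENNReal.ofReal_tsum_of_nonneg (fun _ => Real.exp_nonneg _) (h 1 one_pos)]
  exact ENNReal.ofReal_ne_top

theorem GibbsCond.shEnt_ne_top {E : ℕ → ℝ} (h : GibbsCond E) {r : ℕ → ℝ} (hr : ∀ i, 0 ≤ r i)
    (hE : meanE E r ≠ ⊤) : shEnt r ≠ ⊤ :=
  ne_top_of_le_ne_top (ENNReal.add_ne_top.2 ⟨hE, h.tsum_ne_top⟩) (shEnt_le_meanE_add E r hr)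

theorem GibbsCond.bddAbove {E : ℕ → ℝ} (h : GibbsCond E) (s : ℝ) :
    BddAbove {h : ℝ | ∃ p : ℕ → ℝ, IsProbDist p ∧ meanE E p ≤ ENNReal.ofReal s ∧
      h = (shEnt p).toReal} := by
  refine ⟨(ENNReal.ofReal s + ∑' i, ENNReal.ofReal (Real.exp (-1 * E i))).toReal, ?_⟩
  rintro _ ⟨r, hr, hrs, rfl⟩
  exact ENNReal.toReal_mono (ENNReal.add_ne_top.2 ⟨ENNReal.ofReal_ne_top, h.tsum_ne_top⟩)
    ((shEnt_le_meanE_add E r hr.1).trans (add_le_add_left hrs _))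

theorem GibbsCond.toReal_shEnt_le_FE {E : ℕ → ℝ} (h : GibbsCond E) {s : ℝ} {r : ℕ → ℝ}
    (hr : IsProbDist r) (hrs : meanE E r ≤ ENNReal.ofReal s) : (shEnt r).toReal ≤ FE E s :=
  le_csSup (h.bddAbove s) ⟨r, hr, hrs, rfl⟩

theorem FE_nonneg (E : ℕ → ℝ) (s : ℝ) : 0 ≤ FE E s := by
  refine Real.sSup_nonneg ?_
  rintro _ ⟨r, -, -, rfl⟩
  exact ENNReal.toReal_nonneg

theorem GibbsCond.FE_mono {E : ℕ → ℝ} (h : GibbsCond E) : Monotone (FE E) := by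
  intro s u hsu
  refine Real.sSup_le ?_ (FE_nonneg E u)
  rintro _ ⟨r, hr, hrs, rfl⟩
  exact h.toReal_shEnt_le_FE hr (hrs.trans (ENNReal.ofReal_le_ofReal hsu))

/-- Mixing with the ground state: an unnormalised form of the concavity of `FE`. -/
theorem GibbsCond.mul_toReal_shEnt_le_FE {E : ℕ → ℝ} (h : GibbsCond E) (hE0 : E 0 = 0)
    {r : ℕ → ℝ} (hr : IsProbDist r) {l s : ℝ} (hl0 : 0 ≤ l) (hl1 : l ≤ 1)
    (hrs : ENNReal.ofReal l * meanE E r ≤ ENNReal.ofReal s) :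
    l * (shEnt r).toReal ≤ FE E s := by
  set r' : ℕ → ℝ := fun i => l * r i + (1 - l) * (if i = 0 then 1 else 0) with hr'
  have hprob' : IsProbDist r' := by
    refine ⟨fun i => add_nonneg (mul_nonneg hl0 (hr.1 i))
      (mul_nonneg (by linarith) (by split_ifs <;> norm_num)), ?_⟩
    have := (hr.2.mul_left l).add ((hasSum_ite_eq (0 : ℕ) (1 : ℝ)).mul_left (1 - l))
    simpa [hr'] using this
  have hmean : meanE E r' = ENNReal.ofReal l * meanE E r := by
    rw [meanE, meanE, ← ENNReal.tsum_mul_left]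
    refine tsum_congr fun i => ?_
    rw [← ENNReal.ofReal_mul hl0]
    congr 1
    rcases eq_or_ne i 0 with rfl | hi
    · simp [hE0]
    · simp only [hr', if_neg hi]
      ring
  have hent : ENNReal.ofReal l * shEnt r ≤ shEnt r' := by
    rw [shEnt, shEnt, ← ENNReal.tsum_mul_left]
    refine ENNReal.tsum_le_tsum fun i => ?_
    rw [← ENNReal.ofReal_mul hl0]
    refine ENNReal.ofReal_le_ofReal ?_
    have hc := Real.concaveOn_negMulLog.2 (x := r i) (hr.1 i)
      (y := if i = 0 then (1 : ℝ) else 0) (by split_ifs <;> simp) hl0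
      (sub_nonneg.2 hl1) (by ring)
    have hz : Real.negMulLog (if i = 0 then (1 : ℝ) else 0) = 0 := by split_ifs <;> simp
    simpa [hz, hr'] using hc
  have hle : meanE E r' ≤ ENNReal.ofReal s := hmean ▸ hrs
  have htop : shEnt r' ≠ ⊤ :=
    h.shEnt_ne_top hprob'.1 (ne_top_of_le_ne_top ENNReal.ofReal_ne_top hle)
  have := ENNReal.toReal_mono htop hent
  rw [ENNReal.toReal_mul, ENNReal.toReal_ofReal hl0] at this
  exact this.trans (h.toReal_shEnt_le_FE hprob' hle)

/-- The Alicki–Fannes–Winter comparison of `f p` and `f q` through the normalised parts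
of `p - q`. -/
theorem InClassT.sub_le {n m : ℕ} {C D : ℝ} {P₀ : Set ((Fin n → ℕ) → ℝ)}
    {f : ((Fin n → ℕ) → ℝ) → ℝ} (hf : InClassT m C D P₀ f) (hfnn : ∀ r ∈ P₀, 0 ≤ f r)
    {p q : (Fin n → ℕ) → ℝ} (hp : p ∈ P₀) (hq : q ∈ P₀) (hd : 0 < TVd p q)
    (hplus : (fun x => max (p x - q x) 0 / TVd p q) ∈ P₀)
    (hminus : (fun x => max (q x - p x) 0 / TVd p q) ∈ P₀)
    (htop : margEntSum m (fun x => max (p x - q x) 0 / TVd p q) ≠ ⊤) :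
    f p - f q ≤
      C * (TVd p q * (margEntSum m (fun x => max (p x - q x) 0 / TVd p q)).toReal)
        + D * gFun (TVd p q) := by
  obtain ⟨cm, cp, dm, dp, hcm, hcp, -, -, rfl, rfl, hmix, hbd⟩ := hf
  have hl0 : 0 ≤ 1 / (1 + TVd p q) := by positivity
  have hl1 : 1 / (1 + TVd p q) ≤ 1 := by
    rw [div_le_one (by positivity)]
    linarith
  have h1 := (hmix p hp _ hminus _ hl0 hl1).1
  have h2' := (hmix q hq _ hplus _ hl0 hl1).2
  have hsub : 1 - 1 / (1 + TVd p q) = TVd p q / (1 + TVd p q) := by field_simp; ring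
  have heq : (fun x => 1 / (1 + TVd p q) * p x +
      (1 - 1 / (1 + TVd p q)) * (max (q x - p x) 0 / TVd p q)) =
      fun x => 1 / (1 + TVd p q) * q x +
      (1 - 1 / (1 + TVd p q)) * (max (p x - q x) 0 / TVd p q) := by
    funext x
    rw [hsub]
    field_simp
    rcases le_total (p x) (q x) with h | h
    · rw [max_eq_left (by linarith), max_eq_right (by linarith)]
      ring
    · rw [max_eq_right (by linarith), max_eq_left (by linarith)]
      ring
  rw [heq] at h1
  have h3 := h1.trans h2'
  have hg := one_add_mul_h2 hd
  have hup := (hbd _ hplus htop).2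
  have hlow := hfnn _ hminus
  set d := TVd p q
  set a := f fun x => max (p x - q x) 0 / d
  set b := f fun x => max (q x - p x) 0 / d
  set H := (margEntSum m fun x => max (p x - q x) 0 / d).toReal
  have hH : 0 ≤ H := ENNReal.toReal_nonneg
  have h4 := mul_le_mul_of_nonneg_left h3 (by positivity : 0 ≤ 1 + d)
  rw [hsub] at h4
  have e1 : (1 + d) * (1 / (1 + d) * f p + d / (1 + d) * b - dm * h2 (1 / (1 + d))) =
      f p + d * b - dm * gFun d := by
    rw [← hg]
    field_simp
  have e2 : (1 + d) * (1 / (1 + d) * f q + d / (1 + d) * a + dp * h2 (1 / (1 + d))) =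
      f q + d * a + dp * gFun d := by
    rw [← hg]
    field_simp
  rw [e1, e2] at h4
  have h5 : d * a ≤ d * ((cm + cp) * H) :=
    mul_le_mul_of_nonneg_left (by nlinarith) hd.le
  have h6 : 0 ≤ d * b := mul_nonneg hd.le hlow
  linarith

/-- **One-sided continuity bound under an energy-type constraint on the first
distribution only**, for nonnegative functions of the class `T_n^1(C,D)` on a
convex set `P₀` with the Δ-property: if the first marginal of `p ∈ P₀` has mean
energy at most `t`, then for any `q ∈ P₀` with `TV(p,q) ≤ ε`,
`f(p) − f(q) ≤ C·ε·F_E((t − t_ε(p))/ε) + D·g(ε) ≤ C·ε·F_E(t/ε) + D·g(ε)`,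
where `t_ε(p) = ∑_x E(x 1)·max(p x − ε, 0)`. -/
theorem classT_energy_one_side_bound {n : ℕ} (hn : 1 ≤ n)
    (E : ℕ → ℝ) (hmono : Monotone E) (hE0 : E 0 = 0) (hEnn : ∀ i, 0 ≤ E i)
    (hGibbs : GibbsCond E)
    (P₀ : Set ((Fin n → ℕ) → ℝ)) (hprob : ∀ p ∈ P₀, IsProbDist p)
    (hconv : ConvexDist P₀) (hdelta : DeltaProp P₀)
    (C D : ℝ) (hC : 0 ≤ C) (hD : 0 ≤ D)
    (f : ((Fin n → ℕ) → ℝ) → ℝ) (hf : InClassT 1 C D P₀ f)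
    (hfnn : ∀ r ∈ P₀, 0 ≤ f r)
    (t : ℝ) (ht : 0 < t)
    (p : (Fin n → ℕ) → ℝ) (hp : p ∈ P₀)
    (hpt : meanE E (margN p ⟨0, hn⟩) ≤ ENNReal.ofReal t)
    (q : (Fin n → ℕ) → ℝ) (hq : q ∈ P₀)
    (ε : ℝ) (hε0 : 0 < ε) (hε1 : ε ≤ 1) (hTV : TVd p q ≤ ε) :
    f p - f q ≤
      C * ε * FE E ((t - ∑' x : Fin n → ℕ, E (x ⟨0, hn⟩) * max (p x - ε) 0) / ε)
        + D * gFun ε ∧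
    C * ε * FE E ((t - ∑' x : Fin n → ℕ, E (x ⟨0, hn⟩) * max (p x - ε) 0) / ε)
        + D * gFun ε ≤
      C * ε * FE E (t / ε) + D * gFun ε := by
  have htε : 0 ≤ ∑' x : Fin n → ℕ, E (x ⟨0, hn⟩) * max (p x - ε) 0 :=
    tsum_nonneg fun x => mul_nonneg (hEnn _) (le_max_right _ _)
  refine ⟨?_, ?_⟩
  swap
  · have := hGibbs.FE_mono (div_le_div_of_nonneg_right
      (sub_le_self t htε) hε0.le)
    gcongr
  set T := ∑' x : Fin n → ℕ, E (x ⟨0, hn⟩) * max (p x - ε) 0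
  rcases eq_or_ne p q with rfl | hpq
  · rw [sub_self]
    have := FE_nonneg E ((t - T) / ε)
    have := gFun_nonneg hε0.le
    positivity
  obtain ⟨hplus, hminus⟩ := hdelta p hp q hq hpq
  have hd : 0 < TVd p q := by
    refine lt_of_le_of_ne (mul_nonneg (by norm_num) (tsum_nonneg fun x => abs_nonneg _)) ?_
    intro h0
    have h := (hprob _ hplus).2.tsum_eq
    simp [← h0] at h
  have hΔ := hprob _ hplus
  have hpp := hprob p hp
  have hqq := hprob q hq
  have hmain := hf.sub_le hfnn hp hq hd hplus hminus
  rw [margEntSum_one hn] at hmain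
  set Δ : (Fin n → ℕ) → ℝ := fun x => max (p x - q x) 0 / TVd p q with hΔdef
  set d := TVd p q
  have hdΔ : ∀ x, d * Δ x + max (p x - ε) 0 ≤ p x := by
    intro x
    have h1 : d * Δ x = max (p x - q x) 0 := by simp only [hΔdef]; field_simp
    have h2 : d * Δ x ≤ ε := by nlinarith [hΔ.le_one x, hΔ.1 x]
    have h3 : d * Δ x ≤ p x := h1 ▸ max_le (by linarith [hqq.1 x]) (hpp.1 x)
    rcases le_total (p x - ε) 0 with h | h
    · rw [max_eq_right h]
      linarith
    · rw [max_eq_left h]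
      linarith
  rw [meanE_margN hEnn hpp.1 hpp.2.summable] at hpt
  have hEp0 : ∀ x : Fin n → ℕ, 0 ≤ E (x ⟨0, hn⟩) * p x :=
    fun x => mul_nonneg (hEnn _) (hpp.1 x)
  have hEps : Summable fun x : Fin n → ℕ => E (x ⟨0, hn⟩) * p x := by
    have := ENNReal.summable_toReal (ne_top_of_le_ne_top ENNReal.ofReal_ne_top hpt)
    simpa only [ENNReal.toReal_ofReal (hEp0 _)] using this
  rw [← ENNReal.ofReal_tsum_of_nonneg hEp0 hEps, ENNReal.ofReal_le_ofReal_iff ht.le] at hpt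
  have hΔ0 : ∀ x : Fin n → ℕ, 0 ≤ E (x ⟨0, hn⟩) * (d * Δ x) :=
    fun x => mul_nonneg (hEnn _) (mul_nonneg hd.le (hΔ.1 x))
  have hm0 : ∀ x : Fin n → ℕ, 0 ≤ E (x ⟨0, hn⟩) * max (p x - ε) 0 :=
    fun x => mul_nonneg (hEnn _) (le_max_right _ _)
  have hle : ∀ x : Fin n → ℕ, E (x ⟨0, hn⟩) * (d * Δ x) + E (x ⟨0, hn⟩) * max (p x - ε) 0 ≤
      E (x ⟨0, hn⟩) * p x := fun x => by
    rw [← mul_add]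
    exact mul_le_mul_of_nonneg_left (hdΔ x) (hEnn _)
  have hΔs : Summable fun x : Fin n → ℕ => E (x ⟨0, hn⟩) * (d * Δ x) :=
    hEps.of_nonneg_of_le hΔ0 fun x => by linarith [hle x, hm0 x]
  have hms : Summable fun x : Fin n → ℕ => E (x ⟨0, hn⟩) * max (p x - ε) 0 :=
    hEps.of_nonneg_of_le hm0 fun x => by linarith [hle x, hΔ0 x]
  have hs : ∑' x : Fin n → ℕ, E (x ⟨0, hn⟩) * (d * Δ x) ≤ t - T := by
    have := (hΔs.add hms).tsum_le_tsum hle hEps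
    rw [hΔs.tsum_add hms] at this
    linarith
  have hdE : ENNReal.ofReal d * meanE E (margN Δ ⟨0, hn⟩) ≤ ENNReal.ofReal (t - T) := by
    rw [meanE_margN hEnn hΔ.1 hΔ.2.summable, ← ENNReal.tsum_mul_left]
    simp_rw [← ENNReal.ofReal_mul hd.le, mul_left_comm d]
    rw [← ENNReal.ofReal_tsum_of_nonneg hΔ0 hΔs]
    exact ENNReal.ofReal_le_ofReal hs
  have hEtop : meanE E (margN Δ ⟨0, hn⟩) ≠ ⊤ := by
    intro h
    rw [h, ENNReal.mul_top (by simpa using hd)] at hdE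
    exact ENNReal.ofReal_ne_top (top_le_iff.1 hdE)
  have hmarg := hΔ.margN ⟨0, hn⟩
  have hent : d / ε * (shEnt (margN Δ ⟨0, hn⟩)).toReal ≤ FE E ((t - T) / ε) := by
    refine hGibbs.mul_toReal_shEnt_le_FE hE0 hmarg (by positivity)
      ((div_le_one hε0).2 hTV) ?_
    rw [div_eq_inv_mul, ENNReal.ofReal_mul (by positivity), mul_assoc, div_eq_inv_mul (t - T),
      ENNReal.ofReal_mul (by positivity)]
    gcongr
  have hent' : d * (shEnt (margN Δ ⟨0, hn⟩)).toReal ≤ ε * FE E ((t - T) / ε) := by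
    have := mul_le_mul_of_nonneg_left hent hε0.le
    rwa [← mul_assoc, mul_div_cancel₀ d hε0.ne'] at this
  have hg := gFun_monotoneOn hd.le hε0.le hTV
  calc f p - f q ≤ _ := hmain (hGibbs.shEnt_ne_top hmarg.1 hEtop)
    _ ≤ C * (ε * FE E ((t - T) / ε)) + D * gFun ε := by gcongr
    _ = _ := by ring
end

section
/- Let p be a probability distribution on ℕ with finite support of size r = |{ i : p i > 0 }| ≥ 1. Then for every probability distribution q on ℕ and every ε ∈ (0,1] with TV(p,q) ≤ ε one has H(p) − H(q) ≤ ε·ln r + g(ε), where H(q) is taken in [0,+∞] and the inequality is read in the extended reals. No constraint is imposed on q other than TV(p,q) ≤ ε. -/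
open scoped ENNReal

theorem Real.negMulLog_add_le {x y : ℝ} (hx : 0 ≤ x) (hy : 0 ≤ y) :
    Real.negMulLog (x + y) ≤ Real.negMulLog x + Real.negMulLog y := by
  rcases hx.eq_or_lt with rfl | hx
  · simp
  rcases hy.eq_or_lt with rfl | hy
  · simp
  have h1 : Real.log x ≤ Real.log (x + y) := Real.log_le_log hx (by linarith)
  have h2 : Real.log y ≤ Real.log (x + y) := Real.log_le_log hy (by linarith)
  simp only [Real.negMulLog]
  nlinarith

theorem Real.negMulLog_le_add_mul_log_one_add {x y d : ℝ} (hx : 0 ≤ x) (hxy : x ≤ y)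
    (hd : 0 < d) (hd1 : y - x ≤ d) :
    Real.negMulLog x ≤ Real.negMulLog y + y * Real.log (1 + d) := by
  have hd0 : 0 < 1 + d := by linarith
  have hb : 0 ≤ (y - x) / d := div_nonneg (by linarith) hd.le
  have hconc := Real.concaveOn_negMulLog.2 (Set.mem_Ici.2 hx) (Set.mem_Ici.2 hb)
    (inv_nonneg.2 hd0.le) (div_nonneg hd.le hd0.le) (by field_simp)
  have hpt : (1 + d)⁻¹ * x + d / (1 + d) * ((y - x) / d) = (1 + d)⁻¹ * y := by
    field_simp
    ring
  have hnn := Real.negMulLog_nonneg hb ((div_le_one hd).2 hd1)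
  simp only [smul_eq_mul, hpt] at hconc
  rw [Real.negMulLog_mul] at hconc
  have hinv : Real.negMulLog (1 + d)⁻¹ = (1 + d)⁻¹ * Real.log (1 + d) := by
    simp [Real.negMulLog]
  rw [hinv] at hconc
  have h3 : 0 ≤ d / (1 + d) * Real.negMulLog ((y - x) / d) := by positivity
  have h4 : (1 + d)⁻¹ * Real.negMulLog x ≤
      (1 + d)⁻¹ * (Real.negMulLog y + y * Real.log (1 + d)) := by linarith
  exact le_of_mul_le_mul_left h4 (inv_pos.2 hd0)

theorem Finset.sum_negMulLog_le {ι : Type*} (s : Finset ι) (hs : s.Nonempty) (a : ι → ℝ)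
    (ha : ∀ i ∈ s, 0 ≤ a i) :
    ∑ i ∈ s, Real.negMulLog (a i) ≤
      (∑ i ∈ s, a i) * Real.log s.card + Real.negMulLog (∑ i ∈ s, a i) := by
  have hc : (0 : ℝ) < s.card := by exact_mod_cast hs.card_pos
  have h := Real.concaveOn_negMulLog.le_map_sum (t := s) (w := fun _ => (s.card : ℝ)⁻¹) (p := a)
    (fun _ _ => (inv_pos.2 hc).le) (by simp [hc.ne']) ha
  simp only [smul_eq_mul, ← Finset.mul_sum] at h
  rw [Real.negMulLog_mul] at h
  have hinv : Real.negMulLog (s.card : ℝ)⁻¹ = (s.card : ℝ)⁻¹ * Real.log s.card := by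
    simp [Real.negMulLog]
  rw [hinv] at h
  refine le_of_mul_le_mul_left ?_ (inv_pos.2 hc)
  linarith

theorem IsProbDist.le_one_s11 {α : Type*} {p : α → ℝ} (hp : IsProbDist p) (i : α) : p i ≤ 1 :=
  le_hasSum hp.2 i fun j _ => hp.1 j

theorem IsProbDist.hasSum_abs_sub {α : Type*} {p q : α → ℝ} (hp : IsProbDist p)
    (hq : IsProbDist q) : HasSum (fun i => |p i - q i|) (2 * TVd p q) := by
  have h : Summable fun i => |p i - q i| := (hp.2.summable.sub hq.2.summable).abs
  have h2 : 2 * TVd p q = ∑' i, |p i - q i| := by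
    unfold TVd
    ring
  exact h2 ▸ h.hasSum

theorem IsProbDist.hasSum_posPart_sub {α : Type*} {p q : α → ℝ} (hp : IsProbDist p)
    (hq : IsProbDist q) : HasSum (fun i => max (p i - q i) 0) (TVd p q) := by
  have h := ((hp.hasSum_abs_sub hq).add (hp.2.sub hq.2)).div_const 2
  rw [sub_self, add_zero, mul_div_cancel_left₀ _ two_ne_zero] at h
  refine (funext fun i => ?_ : (fun i => max (p i - q i) 0) = _) ▸ h
  rcases le_total (p i) (q i) with h | h
  · rw [max_eq_right (by linarith), abs_of_nonpos (by linarith)]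
    ring
  · rw [max_eq_left (by linarith), abs_of_nonneg (by linarith)]
    ring

theorem TVd_comm {α : Type*} (p q : α → ℝ) : TVd p q = TVd q p := by
  simp only [TVd, abs_sub_comm]

theorem TVd_nonneg {α : Type*} (p q : α → ℝ) : 0 ≤ TVd p q :=
  mul_nonneg (by norm_num) (tsum_nonneg fun _ => abs_nonneg _)

theorem IsProbDist.negMulLog_le {α : Type*} {p q : α → ℝ} (hp : IsProbDist p)
    (hq : IsProbDist q) (i : α) :
    Real.negMulLog (p i) ≤ Real.negMulLog (q i) + Real.negMulLog (max (p i - q i) 0) +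
      (q i + max (p i - q i) 0) * Real.log (1 + TVd p q) := by
  have hd := TVd_nonneg p q
  have hlog : 0 ≤ Real.log (1 + TVd p q) := Real.log_nonneg (by linarith)
  rcases le_or_gt (q i) (p i) with h | h
  · rw [max_eq_left (by linarith)]
    have h1 := Real.negMulLog_add_le (hq.1 i) (sub_nonneg.2 h)
    have h2 := mul_nonneg (hp.1 i) hlog
    rw [add_sub_cancel] at h1 ⊢
    linarith
  · rw [max_eq_right (by linarith)]
    have h1 : max (q i - p i) 0 ≤ TVd p q := by
      rw [TVd_comm]
      exact le_hasSum (hq.hasSum_posPart_sub hp) i fun _ _ => le_max_right _ _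
    have h2 := (le_max_left _ _).trans h1
    simpa using Real.negMulLog_le_add_mul_log_one_add (hp.1 i) h.le (by linarith) h2

theorem IsProbDist.sum_negMulLog_le {α : Type*} {p q : α → ℝ} (hp : IsProbDist p)
    (hq : IsProbDist q) (s : Finset α) (hs : s.Nonempty) (hsupp : ∀ i ∉ s, p i = 0) :
    ∑ i ∈ s, Real.negMulLog (p i) ≤
      TVd p q * Real.log s.card + gFun (TVd p q) + ∑ i ∈ s, Real.negMulLog (q i) := by
  have hpos := hp.hasSum_posPart_sub hq
  have ha : ∑ i ∈ s, max (p i - q i) 0 = TVd p q := by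
    refine (hasSum_sum_of_ne_finset_zero fun i hi => ?_).unique hpos
    rw [hsupp i hi, zero_sub]
    exact max_eq_right (neg_nonpos.2 (hq.1 i))
  have hm : ∑ i ∈ s, (q i + max (p i - q i) 0) ≤ 1 + TVd p q :=
    sum_le_hasSum s (fun i _ => add_nonneg (hq.1 i) (le_max_right _ _)) (hq.2.add hpos)
  have hJ := s.sum_negMulLog_le hs (fun i => max (p i - q i) 0) fun _ _ => le_max_right _ _
  have hterm := Finset.sum_le_sum fun i (_ : i ∈ s) => hp.negMulLog_le hq i
  rw [Finset.sum_add_distrib, Finset.sum_add_distrib, ← Finset.sum_mul] at hterm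
  have hlog : 0 ≤ Real.log (1 + TVd p q) :=
    Real.log_nonneg (by linarith [TVd_nonneg p q])
  have hmul := mul_le_mul_of_nonneg_right hm hlog
  rw [ha] at hJ
  have hg : gFun (TVd p q) =
      (1 + TVd p q) * Real.log (1 + TVd p q) + Real.negMulLog (TVd p q) := by
    rw [gFun, Real.negMulLog, add_comm (TVd p q) 1]
    ring
  linarith

/-- **One-sided continuity bound for the Shannon entropy under a rank constraint
on the first distribution only** (classical form): if `p` has finite support of
size `r ≥ 1` then for any probability distribution `q` with `TV(p,q) ≤ ε`,
`H(p) − H(q) ≤ ε·ln r + g(ε)` in the extended reals. -/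
theorem entropy_rank_one_side_bound
    (p : ℕ → ℝ) (hp : IsProbDist p)
    (hfin : (Function.support p).Finite)
    (r : ℕ) (hr : r = (Function.support p).ncard) (hr1 : 1 ≤ r)
    (q : ℕ → ℝ) (hq : IsProbDist q)
    (ε : ℝ) (hε0 : 0 < ε) (hε1 : ε ≤ 1) (hTV : TVd p q ≤ ε) :
    (shEnt p : EReal) - (shEnt q : EReal) ≤
      ((ε * Real.log r + gFun ε : ℝ) : EReal) := by
  have hcard : hfin.toFinset.card = r := by rw [hr, Set.ncard_eq_toFinset_card _ hfin]
  have hs : hfin.toFinset.Nonempty := Finset.card_pos.1 (by omega)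
  have hsupp : ∀ i ∉ hfin.toFinset, p i = 0 := by simp
  have hmain := hp.sum_negMulLog_le hq _ hs hsupp
  rw [hcard] at hmain
  have hlog : 0 ≤ Real.log r := Real.log_nonneg (by exact_mod_cast hr1)
  have hg := gFun_monotoneOn (Set.mem_Ici.2 (TVd_nonneg p q)) (Set.mem_Ici.2 hε0.le) hTV
  have hg0 := gFun_monotoneOn (Set.mem_Ici.2 le_rfl) (Set.mem_Ici.2 hε0.le) hε0.le
  have hzero : gFun 0 = 0 := by simp [gFun]
  have hC : 0 ≤ ε * Real.log r + gFun ε := add_nonneg (by positivity) (hzero ▸ hg0)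
  have hmul := mul_le_mul_of_nonneg_right hTV hlog
  have hp_ent : shEnt p = ENNReal.ofReal (∑ i ∈ hfin.toFinset, Real.negMulLog (p i)) := by
    rw [ENNReal.ofReal_sum_of_nonneg fun i _ => Real.negMulLog_nonneg (hp.1 i) (hp.le_one_s11 i)]
    exact tsum_eq_sum fun i hi => by simp [hsupp i hi]
  have hq_ent : ENNReal.ofReal (∑ i ∈ hfin.toFinset, Real.negMulLog (q i)) ≤ shEnt q := by
    rw [ENNReal.ofReal_sum_of_nonneg fun i _ => Real.negMulLog_nonneg (hq.1 i) (hq.le_one_s11 i)]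
    exact ENNReal.sum_le_tsum _
  have hle : shEnt p ≤ ENNReal.ofReal (ε * Real.log r + gFun ε) + shEnt q := by
    refine le_trans ?_ (add_le_add_right hq_ent _)
    rw [hp_ent]
    exact (ENNReal.ofReal_le_ofReal (by linarith)).trans ENNReal.ofReal_add_le
  refine EReal.sub_le_of_le_add ?_
  have hcast := EReal.coe_ennreal_le_coe_ennreal_iff.2 hle
  rwa [EReal.coe_ennreal_add, EReal.coe_ennreal_ofReal, max_eq_left hC] at hcast
end
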